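/- arXiv:math/0607384 — 3 statements merged into one kernel-verified Lean document; each statement's English description precedes it below -/
import Mathlib

section
/- Let f : ℕ → ℝ be a positive monotone increasing function with f(n) → ∞ as n → ∞. Suppose there exist an integer m ≥ 2 and real numbers C > 0 and α > 0 such that f(n) ≥ C · (f(⌊α·n⌋))^m for all n ≥ 1. Then there exist real numbers A > 0, ν > 0 and N such that f(n) ≥ exp(A · n^ν) for all n ≥ N. -/
/-- **Lower Bound Lemma.** If `f : ℕ → ℝ` is a positive monotone increasing function
tending to infinity which satisfies `f n ≥ C * (f ⌊α n⌋)^m` for some integer `m ≥ 2` and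
reals `C, α > 0`, then `f n ≥ exp (A * n^ν)` for some `A, ν > 0` and all sufficiently
large `n`. -/
theorem lower_bound_lemma (f : ℕ → ℝ) (hpos : ∀ n, 0 < f n) (hmono : Monotone f)
    (htend : Filter.Tendsto f Filter.atTop Filter.atTop)
    (m : ℕ) (hm : 2 ≤ m) (C α : ℝ) (hC : 0 < C) (hα : 0 < α)
    (hrec : ∀ n : ℕ, 1 ≤ n → C * (f ⌊α * (n : ℝ)⌋₊) ^ m ≤ f n) :
    ∃ A ν : ℝ, 0 < A ∧ 0 < ν ∧ ∃ N : ℕ, ∀ n, N ≤ n → Real.exp (A * (n : ℝ) ^ ν) ≤ f n := by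
  obtain ⟨K, hK⟩ := exists_nat_ge (max 2 (1 / α))
  have hK2 : (2 : ℝ) ≤ K := le_trans (le_max_left _ _) hK
  have hKα : 1 ≤ α * K := by
    have h1 : 1 / α ≤ K := le_trans (le_max_right _ _) hK
    rw [div_le_iff₀ hα] at h1
    linarith
  have hK2n : 2 ≤ K := by exact_mod_cast hK2
  obtain ⟨c, hc0, hc1, hcC⟩ : ∃ c : ℝ, 0 < c ∧ c ≤ 1 ∧ c ≤ C :=
    ⟨min 1 C, lt_min one_pos hC, min_le_left _ _, min_le_right _ _⟩
  obtain ⟨j, hj1, hjf⟩ : ∃ j : ℕ, 1 ≤ j ∧ max 1 (Real.exp 1 / c) ≤ f j :=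
    ((Filter.eventually_ge_atTop 1).and (htend.eventually_ge_atTop _)).exists
  have hf1 : 1 ≤ f j := le_trans (le_max_left _ _) hjf
  have hfe : Real.exp 1 ≤ c * f j := by
    have h1 : Real.exp 1 / c ≤ f j := le_trans (le_max_right _ _) hjf
    rw [div_le_iff₀ hc0] at h1
    linarith
  have step : ∀ n : ℕ, j ≤ n → (c * f n) ^ 2 ≤ c * f (K * n) := by
    intro n hn
    have hn1 : 1 ≤ n := le_trans hj1 hn
    have h1 : 1 ≤ f n := le_trans hf1 (hmono hn)
    have h2 := hrec (K * n) (by nlinarith)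
    have h3 : n ≤ ⌊α * ((K * n : ℕ) : ℝ)⌋₊ := by
      apply Nat.le_floor
      push_cast
      have : (0 : ℝ) ≤ n := Nat.cast_nonneg n
      nlinarith
    have h4 : f n ^ 2 ≤ f ⌊α * ((K * n : ℕ) : ℝ)⌋₊ ^ m :=
      le_trans (pow_le_pow_right₀ h1 hm) (pow_le_pow_left₀ (by linarith) (hmono h3) m)
    have h5 : c * f n ^ 2 ≤ f (K * n) :=
      le_trans (mul_le_mul hcC h4 (by positivity) hC.le) h2
    calc (c * f n) ^ 2 = c * (c * f n ^ 2) := by ring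
      _ ≤ c * f (K * n) := mul_le_mul_of_nonneg_left h5 hc0.le
  have iter : ∀ i : ℕ, Real.exp (2 ^ i) ≤ c * f (K ^ i * j) := by
    intro i
    induction i with
    | zero => simpa using hfe
    | succ i ih =>
      have h1 : j ≤ K ^ i * j := Nat.le_mul_of_pos_left _ (by positivity)
      have h2 := step _ h1
      calc Real.exp (2 ^ (i + 1)) = Real.exp (2 ^ i) ^ 2 := by
            rw [← Real.exp_nat_mul]; congr 1; push_cast; ring
        _ ≤ (c * f (K ^ i * j)) ^ 2 := pow_le_pow_left₀ (Real.exp_pos _).le ih 2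
        _ ≤ c * f (K * (K ^ i * j)) := h2
        _ = c * f (K ^ (i + 1) * j) := by rw [← mul_assoc, pow_succ']
  have hjpos : (0 : ℝ) < j := by exact_mod_cast hj1
  have hν : 0 < Real.logb K 2 := Real.logb_pos (by linarith) (by norm_num)
  have hKν : (K : ℝ) ^ Real.logb K 2 = 2 :=
    Real.rpow_logb (by linarith) (by linarith) (by norm_num)
  have hjν : 0 < (j : ℝ) ^ Real.logb K 2 := Real.rpow_pos_of_pos hjpos _
  refine ⟨1 / (2 * (j : ℝ) ^ Real.logb K 2), Real.logb K 2, by positivity, hν, j, ?_⟩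
  intro n hn
  set i := Nat.log K (n / j) with hi
  have hq : n / j ≠ 0 := (Nat.div_pos hn hj1).ne'
  have hlo : K ^ i * j ≤ n :=
    (Nat.le_div_iff_mul_le hj1).1 (Nat.pow_log_le_self K hq)
  have hhi : n < K ^ (i + 1) * j :=
    (Nat.div_lt_iff_lt_mul hj1).1 (Nat.lt_pow_succ_log_self hK2n (n / j))
  have hhiR : (n : ℝ) ≤ (K : ℝ) ^ (i + 1) * j := by exact_mod_cast hhi.le
  have hnν : (n : ℝ) ^ Real.logb K 2 ≤ 2 ^ (i + 1) * (j : ℝ) ^ Real.logb K 2 := by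
    calc (n : ℝ) ^ Real.logb K 2 ≤ ((K : ℝ) ^ (i + 1) * j) ^ Real.logb K 2 :=
          Real.rpow_le_rpow (Nat.cast_nonneg n) hhiR hν.le
      _ = ((K : ℝ) ^ Real.logb K 2) ^ (i + 1) * (j : ℝ) ^ Real.logb K 2 := by
          rw [Real.mul_rpow (by positivity) hjpos.le, Real.rpow_pow_comm (by positivity)]
      _ = _ := by rw [hKν]
  calc Real.exp (1 / (2 * (j : ℝ) ^ Real.logb K 2) * (n : ℝ) ^ Real.logb K 2)
      ≤ Real.exp (2 ^ i) := by
        apply Real.exp_le_exp.2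
        rw [one_div_mul_eq_div, div_le_iff₀ (by positivity)]
        calc _ ≤ _ := hnν
          _ = _ := by ring
    _ ≤ c * f (K ^ i * j) := iter i
    _ ≤ f (K ^ i * j) := mul_le_of_le_one_left (hpos _).le hc1
    _ ≤ f n := hmono hlo
end

section
/- Let f : ℕ → ℝ be a nonnegative monotone increasing function with f(n) → ∞ as n → ∞. Suppose there exist an integer k ≥ 2 and real numbers C > 0 and 0 < α < 1 such that f(n) ≤ C · f^{⋆k}(⌊α·n⌋) for all n ≥ 1. Then there exist real numbers β with 0 < β < 1 and B > 0, D > 0 such that f(n) ≤ B · exp(D · n^β) for all n. -/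
/-- The `k`-fold star convolution `f^{⋆k}(n) = Σ f(n₁) ⋯ f(n_k)`, summed over all
`k`-tuples `(n₁, …, n_k)` of natural numbers with `n₁ + … + n_k ≤ n`. -/
noncomputable def starConv (f : ℕ → ℝ) (k n : ℕ) : ℝ :=
  ∑ t ∈ (Fintype.piFinset fun _ : Fin k => Finset.range (n + 1)) |>.filter
      (fun t => ∑ i, t i ≤ n),
    ∏ i, f (t i)

/-- **Upper Bound Lemma.** If `f : ℕ → ℝ` is a nonnegative monotone increasing function
tending to infinity which satisfies `f n ≤ C * f^{⋆k}(⌊α n⌋)` for some integer `k ≥ 2`,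
`C > 0` and `0 < α < 1`, then `f n ≤ B * exp (D * n^β)` for some `0 < β < 1` and
`B, D > 0`. -/
theorem upper_bound_lemma (f : ℕ → ℝ) (hnn : ∀ n, 0 ≤ f n) (hmono : Monotone f)
    (htend : Filter.Tendsto f Filter.atTop Filter.atTop)
    (k : ℕ) (hk : 2 ≤ k) (C α : ℝ) (hC : 0 < C) (hα0 : 0 < α) (hα1 : α < 1)
    (hrec : ∀ n : ℕ, 1 ≤ n → f n ≤ C * starConv f k ⌊α * (n : ℝ)⌋₊) :
    ∃ β B D : ℝ, 0 < β ∧ β < 1 ∧ 0 < B ∧ 0 < D ∧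
      ∀ n : ℕ, f n ≤ B * Real.exp (D * (n : ℝ) ^ β) := by
  have hk0 : (0 : ℝ) < k := by
    have : 0 < k := by omega
    exact_mod_cast this
  obtain ⟨β, hβ0, hβ1, hq⟩ : ∃ β : ℝ, 0 < β ∧ β < 1 ∧ (k : ℝ) * (α / k) ^ β < 1 := by
    have hc : ContinuousAt (fun β : ℝ => (k : ℝ) * (α / k) ^ β) 1 := by
      apply ContinuousAt.mul continuousAt_const
      exact Real.continuousAt_const_rpow (by positivity)
    have h1 : (k : ℝ) * (α / k) ^ (1 : ℝ) < 1 := by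
      rw [Real.rpow_one, mul_div_cancel₀ _ hk0.ne']
      exact hα1
    have e1 := (hc.eventually_lt continuousAt_const h1).filter_mono
      (nhdsWithin_le_nhds (s := Set.Iio (1 : ℝ)))
    have e2 : ∀ᶠ x : ℝ in nhdsWithin 1 (Set.Iio 1), 0 < x :=
      (lt_mem_nhds one_pos).filter_mono nhdsWithin_le_nhds
    have e3 : ∀ᶠ x : ℝ in nhdsWithin 1 (Set.Iio 1), x < 1 := self_mem_nhdsWithin
    obtain ⟨x, hx⟩ := (e1.and (e2.and e3)).exists
    exact ⟨x, hx.2.1, hx.2.2, hx.1⟩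
  set q : ℝ := (k : ℝ) * (α / k) ^ β with hqdef
  set B : ℝ := max (f 0) 1 with hB
  have hB1 : 1 ≤ B := le_max_right _ _
  have hBpos : 0 < B := by linarith
  set E : ℝ := C * B ^ k + k * (2 / β) with hE
  have hEpos : 0 < E := by positivity
  set D : ℝ := E / (1 - q) with hD
  have hq' : 0 < 1 - q := by linarith
  have hDpos : 0 < D := by positivity
  have hDE : D * (1 - q) = E := div_mul_cancel₀ _ hq'.ne'
  refine ⟨β, B, D, hβ0, hβ1, hBpos, hDpos, ?_⟩
  intro n
  induction n using Nat.strong_induction_on with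
  | _ n ih =>
  rcases Nat.eq_zero_or_pos n with rfl | hn
  · rw [Nat.cast_zero, Real.zero_rpow hβ0.ne', mul_zero, Real.exp_zero, mul_one]
    exact le_max_left _ _
  have hnR : (1 : ℝ) ≤ n := by exact_mod_cast hn
  set m : ℕ := ⌊α * (n : ℝ)⌋₊ with hm
  have hmle : (m : ℝ) ≤ α * n := Nat.floor_le (by positivity)
  have hmn : m < n := by
    have : (m : ℝ) < n := by nlinarith
    exact_mod_cast this
  have hx1 : (1 : ℝ) ≤ (n : ℝ) ^ β := Real.one_le_rpow hnR hβ0.le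
  -- each term of the sum
  have hterm : ∀ t ∈ (Fintype.piFinset fun _ : Fin k => Finset.range (m + 1)).filter
      (fun t => ∑ i, t i ≤ m), ∏ i, f (t i) ≤ B ^ k * Real.exp (D * (q * (n : ℝ) ^ β)) := by
    intro t ht
    rw [Finset.mem_filter, Fintype.mem_piFinset] at ht
    obtain ⟨ht1, ht2⟩ := ht
    have hsum : ∑ i, ((t i : ℕ) : ℝ) ^ β ≤ q * (n : ℝ) ^ β := by
      have hj := (Real.concaveOn_rpow hβ0.le hβ1.le).le_map_sum (t := Finset.univ)
        (w := fun _ : Fin k => (1 : ℝ) / k) (p := fun i => (t i : ℝ))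
        (fun i _ => by positivity) (by simp [hk0.ne']) (fun i _ => by simp)
      simp only [smul_eq_mul, ← Finset.mul_sum] at hj
      have hs : ∑ i, (t i : ℝ) ≤ α * n := by
        refine le_trans ?_ hmle
        exact_mod_cast ht2
      have h2 : ((1 : ℝ) / k * ∑ i, (t i : ℝ)) ^ β ≤ (α / k * n) ^ β := by
        apply Real.rpow_le_rpow (by positivity) _ hβ0.le
        calc (1 : ℝ) / k * ∑ i, (t i : ℝ) ≤ 1 / k * (α * n) := by gcongr
          _ = α / k * n := by ring
      rw [Real.mul_rpow (x := α / k) (by positivity) (by positivity)] at h2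
      have h3 := mul_le_mul_of_nonneg_left (hj.trans h2) hk0.le
      rw [← mul_assoc, mul_one_div_cancel hk0.ne', one_mul, ← mul_assoc] at h3
      exact h3
    calc ∏ i, f (t i) ≤ ∏ i, (B * Real.exp (D * (t i : ℝ) ^ β)) := by
          apply Finset.prod_le_prod (fun i _ => hnn _)
          intro i _
          apply ih
          have := Finset.mem_range.1 (ht1 i)
          omega
      _ = B ^ k * Real.exp (D * ∑ i, (t i : ℝ) ^ β) := by
          rw [Finset.prod_mul_distrib, ← Real.exp_sum, Finset.mul_sum]
          simp
      _ ≤ _ := by gcongr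
  have hcard : ((((Fintype.piFinset fun _ : Fin k => Finset.range (m + 1)).filter
      (fun t => ∑ i, t i ≤ m)).card : ℕ) : ℝ) ≤ ((n : ℝ) + 1) ^ k := by
    have h1 : ((Fintype.piFinset fun _ : Fin k => Finset.range (m + 1)).filter
      (fun t => ∑ i, t i ≤ m)).card ≤ (n + 1) ^ k := by
      refine (Finset.card_filter_le _ _).trans ?_
      rw [Fintype.card_piFinset]
      simp only [Finset.card_range, Finset.prod_const, Finset.card_univ, Fintype.card_fin]
      gcongr
    exact_mod_cast h1
  have hconv : starConv f k m ≤
      ((n : ℝ) + 1) ^ k * (B ^ k * Real.exp (D * (q * (n : ℝ) ^ β))) := by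
    unfold starConv
    refine (Finset.sum_le_card_nsmul _ _ _ hterm).trans ?_
    rw [nsmul_eq_mul]
    gcongr
  have hpoly : ((n : ℝ) + 1) ≤ Real.exp (2 / β * (n : ℝ) ^ β) := by
    rw [← Real.log_le_iff_le_exp (by positivity)]
    refine (Real.log_le_rpow_div (by positivity) hβ0).trans ?_
    have h2 : ((n : ℝ) + 1) ^ β ≤ 2 * (n : ℝ) ^ β := by
      calc ((n : ℝ) + 1) ^ β ≤ (2 * n) ^ β :=
            Real.rpow_le_rpow (by positivity) (by linarith) hβ0.le
        _ = 2 ^ β * (n : ℝ) ^ β := Real.mul_rpow (by norm_num) (by positivity)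
        _ ≤ 2 ^ (1 : ℝ) * (n : ℝ) ^ β := by
            gcongr
            norm_num
        _ = _ := by rw [Real.rpow_one]
    rw [div_mul_eq_mul_div]
    gcongr
  have hconst : C * B ^ k ≤ Real.exp (C * B ^ k * (n : ℝ) ^ β) := by
    have h1 := Real.add_one_le_exp (C * B ^ k * (n : ℝ) ^ β)
    have h2 : C * B ^ k ≤ C * B ^ k * (n : ℝ) ^ β := le_mul_of_one_le_right (by positivity) hx1
    linarith
  calc f n ≤ C * starConv f k m := hrec n hn
    _ ≤ C * (((n : ℝ) + 1) ^ k * (B ^ k * Real.exp (D * (q * (n : ℝ) ^ β)))) := by gcongr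
    _ = (C * B ^ k) * ((n : ℝ) + 1) ^ k * Real.exp (D * (q * (n : ℝ) ^ β)) := by ring
    _ ≤ Real.exp (C * B ^ k * (n : ℝ) ^ β) * (Real.exp (2 / β * (n : ℝ) ^ β)) ^ k
          * Real.exp (D * (q * (n : ℝ) ^ β)) := by gcongr
    _ = Real.exp (D * (n : ℝ) ^ β) := by
        rw [← Real.exp_nat_mul, ← Real.exp_add, ← Real.exp_add]
        congr 1
        have : D = E + D * q := by linarith
        calc _ = (E + D * q) * (n : ℝ) ^ β := by rw [hE]; ring
          _ = _ := by rw [← this]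
    _ ≤ B * Real.exp (D * (n : ℝ) ^ β) := le_mul_of_one_le_left (Real.exp_pos _).le hB1
end

section
/- Every multilateral group has superpolynomial growth: let G be an infinite group generated by a finite set S, let m ≥ 2 be an integer, and suppose there exist a finite-index subgroup H of G and a finite-index subgroup K of the direct product G^m of m copies of G such that H and K are isomorphic as groups. Then there exist real numbers c > 0, α > 0 and N such that the growth function of G with respect to S satisfies γ(n) ≥ exp(c·n^α) for all n ≥ N. -/
/-- The ball of radius `n` in a group `G` with respect to a generating set `S`: the set of
elements of `G` expressible as products of at most `n` elements of `S ∪ S⁻¹`. -/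
def wordBall (G : Type*) [Group G] (S : Set G) (n : ℕ) : Set G :=
  {g | ∃ l : List G, l.length ≤ n ∧ (∀ x ∈ l, x ∈ S ∨ x⁻¹ ∈ S) ∧ l.prod = g}

/-- The growth function `γ(n)` of `G` with respect to `S`: the number of elements of word
length at most `n`. -/
noncomputable def growth (G : Type*) [Group G] (S : Set G) (n : ℕ) : ℕ :=
  Nat.card (wordBall G S n)

open scoped Pointwise

/-- The symmetrised generating set with `1` added. -/
def symGen {G : Type*} [Group G] (S : Set G) : Set G := {x | x = 1 ∨ x ∈ S ∨ x⁻¹ ∈ S}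

theorem one_mem_symGen {G : Type*} [Group G] (S : Set G) : (1 : G) ∈ symGen S := Or.inl rfl

theorem wordBall_eq {G : Type*} [Group G] (S : Set G) (n : ℕ) :
    wordBall G S n = symGen S ^ n := by
  induction n with
  | zero =>
    ext g
    simp only [wordBall, Set.mem_ofPred_eq, pow_zero, Set.mem_one]
    constructor
    · rintro ⟨l, hl, -, rfl⟩
      have : l = [] := by simpa using hl
      simp [this]
    · rintro rfl
      exact ⟨[], by simp, by simp, rfl⟩
  | succ n ih =>
    rw [pow_succ', ← ih]
    ext g
    rw [Set.mem_mul]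
    constructor
    · rintro ⟨l, hl, hx, rfl⟩
      cases l with
      | nil => exact ⟨1, one_mem_symGen S, 1, ⟨[], by simp, by simp, rfl⟩, by simp⟩
      | cons a l =>
        refine ⟨a, Or.inr (hx a (by simp)), l.prod, ⟨l, by simpa using hl, ?_, rfl⟩, by simp⟩
        intro x h
        exact hx x (by simp [h])
    · rintro ⟨a, ha, b, ⟨l, hl, hx, rfl⟩, rfl⟩
      rcases ha with rfl | ha
      · exact ⟨l, by omega, hx, by simp⟩
      · refine ⟨a :: l, by simpa using hl, ?_, by simp⟩
        intro x h
        rcases List.mem_cons.1 h with rfl | h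
        · exact ha
        · exact hx x h

theorem symGen_finite {G : Type*} [Group G] (S : Finset G) : (symGen (S : Set G)).Finite := by
  have : symGen (S : Set G) ⊆ {1} ∪ ((S : Set G) ∪ (S : Set G)⁻¹) := by
    rintro x (h | h | h)
    · exact Or.inl h
    · exact Or.inr (Or.inl h)
    · exact Or.inr (Or.inr h)
  refine Set.Finite.subset ?_ this
  exact (Set.finite_singleton _).union (S.finite_toSet.union S.finite_toSet.inv)

theorem finite_pow {G : Type*} [Group G] {U : Set G} (hU : U.Finite) (n : ℕ) :
    (U ^ n).Finite := by
  induction n with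
  | zero => rw [pow_zero, ← Set.singleton_one]; exact Set.finite_singleton _
  | succ n ih => rw [pow_succ]; exact ih.mul hU

theorem symGen_inv {G : Type*} [Group G] (S : Set G) : (symGen S)⁻¹ = symGen S := by
  ext x
  simp only [symGen, Set.mem_inv, Set.mem_ofPred_eq, inv_eq_one, inv_inv]
  tauto

theorem symGen_pow_mono {G : Type*} [Group G] (S : Set G) {a b : ℕ} (h : a ≤ b) :
    symGen S ^ a ⊆ symGen S ^ b :=
  Set.pow_subset_pow_right (one_mem_symGen S) h

theorem exists_mem_pow {G : Type*} [Group G] (S : Set G) (hS : Subgroup.closure S = ⊤) (g : G) :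
    ∃ n, g ∈ symGen S ^ n := by
  have hg : g ∈ Subgroup.closure S := by rw [hS]; trivial
  induction hg using Subgroup.closure_induction with
  | mem x hx => exact ⟨1, by rw [pow_one]; exact Or.inr (Or.inl hx)⟩
  | one => exact ⟨0, by simp⟩
  | mul x y _ _ hx hy =>
    obtain ⟨a, ha⟩ := hx
    obtain ⟨b, hb⟩ := hy
    exact ⟨a + b, by rw [pow_add]; exact Set.mul_mem_mul ha hb⟩
  | inv x _ hx =>
    obtain ⟨a, ha⟩ := hx
    refine ⟨a, ?_⟩
    rw [← symGen_inv, inv_pow, Set.mem_inv, inv_inv]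
    exact ha

theorem exists_subset_pow {G : Type*} [Group G] (S : Set G) (hS : Subgroup.closure S = ⊤)
    (F : Set G) (hF : F.Finite) : ∃ n, F ⊆ symGen S ^ n := by
  induction F, hF using Set.Finite.induction_on with
  | empty => exact ⟨0, by simp⟩
  | insert _ _ ih =>
    rename_i a s _ _
    obtain ⟨n, hn⟩ := ih
    obtain ⟨k, hk⟩ := exists_mem_pow S hS a
    refine ⟨n + k, Set.insert_subset (symGen_pow_mono S (by omega) hk) ?_⟩
    exact hn.trans (symGen_pow_mono S (by omega))

theorem pi_pow {G : Type*} [Group G] (m : ℕ) (U : Set G) (n : ℕ) :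
    (Set.pi Set.univ (fun _ : Fin m => U ^ n)) ⊆ (Set.pi Set.univ (fun _ : Fin m => U)) ^ n := by
  induction n with
  | zero =>
    intro x hx
    simp only [pow_zero, Set.mem_one]
    ext i
    simpa using hx i trivial
  | succ n ih =>
    intro x hx
    have h : ∀ i, ∃ a ∈ U ^ n, ∃ b ∈ U, a * b = x i := by
      intro i
      have := hx i trivial
      simp only [pow_succ] at this
      exact Set.mem_mul.1 this
    choose a ha b hb hab using h
    rw [pow_succ]
    refine Set.mem_mul.2 ⟨a, ih (fun i _ => ha i), b, fun i _ => hb i, ?_⟩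
    ext i
    exact hab i

/-- A coset representative `σ x` with `x * σ x ∈ K`. -/
noncomputable def cosetRep {Γ : Type*} [Group Γ] (K : Subgroup Γ) (x : Γ) : Γ :=
  Quotient.out ((x⁻¹ : Γ) : Γ ⧸ K)

theorem mul_cosetRep_mem {Γ : Type*} [Group Γ] (K : Subgroup Γ) (x : Γ) :
    x * cosetRep K x ∈ K := by
  have h : ((x⁻¹ : Γ) : Γ ⧸ K) = ((cosetRep K x : Γ) : Γ ⧸ K) :=
    (QuotientGroup.out_eq' _).symm
  have := QuotientGroup.eq.1 h
  simpa using this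

theorem schreier_bound {Γ G : Type*} [Group Γ] [Group G] (T : Set Γ) (hT : T.Finite)
    (K : Subgroup Γ) [K.FiniteIndex] (f : K →* G) (U : Set G)
    (hU : ∀ F : Set G, F.Finite → ∃ n, F ⊆ U ^ n) :
    ∃ C : ℕ, ∀ n, ∀ x ∈ T ^ n,
      f ⟨x * cosetRep K x, mul_cosetRep_mem K x⟩ ∈ U ^ (C * (n + 1)) := by
  let R : Set Γ := Set.range (fun q : Γ ⧸ K => Quotient.out q)
  have hR : R.Finite := Set.finite_range _
  let E : Set Γ := (R⁻¹ * T * R) ∪ R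
  have hE : E.Finite := ((hR.inv.mul hT).mul hR).union hR
  let F : Set G := f '' ((fun k : K => (k : Γ)) ⁻¹' E)
  have hF : F.Finite := (hE.preimage (Subtype.val_injective.injOn)).image f
  obtain ⟨C, hC⟩ := hU F hF
  have hrep : ∀ x, cosetRep K x ∈ R := fun x => ⟨_, rfl⟩
  refine ⟨C, fun n => ?_⟩
  induction n with
  | zero =>
    intro x hx
    have hx : x = 1 := by simpa using hx
    rw [zero_add, mul_one]
    apply hC
    refine ⟨_, ?_, rfl⟩
    right
    subst hx
    simpa using hrep 1
  | succ n ih =>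
    intro x hx
    rw [pow_succ] at hx
    obtain ⟨y, hy, t, ht, rfl⟩ := Set.mem_mul.1 hx
    have hk : (cosetRep K y)⁻¹ * t * cosetRep K (y * t) ∈ K := by
      have h1 := K.mul_mem (K.inv_mem (mul_cosetRep_mem K y)) (mul_cosetRep_mem K (y * t))
      convert h1 using 1
      group
    have hsplit : (⟨y * t * cosetRep K (y * t), mul_cosetRep_mem K (y * t)⟩ : K)
        = ⟨y * cosetRep K y, mul_cosetRep_mem K y⟩ *
          ⟨(cosetRep K y)⁻¹ * t * cosetRep K (y * t), hk⟩ := by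
      apply Subtype.ext
      simp only [Subgroup.coe_mul]
      group
    rw [hsplit, map_mul, mul_add C (n + 1) 1, mul_one, pow_add]
    refine Set.mul_mem_mul (ih y hy) (hC ⟨_, ?_, rfl⟩)
    left
    exact Set.mul_mem_mul (Set.mul_mem_mul (Set.inv_mem_inv.2 (hrep y)) ht) (hrep _)

theorem growth_eq {G : Type*} [Group G] (S : Set G) (n : ℕ) :
    growth G S n = (symGen S ^ n).ncard := by
  rw [growth, wordBall_eq]
  rfl

theorem growth_mono {G : Type*} [Group G] (S : Finset G) {a b : ℕ} (h : a ≤ b) :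
    growth G (S : Set G) a ≤ growth G (S : Set G) b := by
  rw [growth_eq, growth_eq]
  exact Set.ncard_le_ncard (symGen_pow_mono _ h) (finite_pow (symGen_finite S) _)

theorem growth_pos {G : Type*} [Group G] (S : Finset G) (n : ℕ) :
    1 ≤ growth G (S : Set G) n := by
  refine le_trans ?_ (growth_mono S (Nat.zero_le n))
  rw [growth_eq, pow_zero, ← Set.singleton_one, Set.ncard_singleton]

theorem growth_unbounded {G : Type*} [Group G] [Infinite G] (S : Finset G)
    (hS : Subgroup.closure (S : Set G) = ⊤) (M : ℕ) : ∃ n, M ≤ growth G (S : Set G) n := by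
  obtain ⟨F, hF⟩ := Infinite.exists_subset_card_eq G M
  obtain ⟨n, hn⟩ := exists_subset_pow _ hS (F : Set G) F.finite_toSet
  refine ⟨n, ?_⟩
  rw [growth_eq, ← hF, ← Set.ncard_coe_finset]
  exact Set.ncard_le_ncard hn (finite_pow (symGen_finite S) _)

theorem growth_pow_le {G : Type*} [Group G]
    (S : Finset G) (hS : Subgroup.closure (S : Set G) = ⊤)
    (m : ℕ) (K : Subgroup (Fin m → G)) [K.FiniteIndex] (f : K →* G)
    (hf : Function.Injective f) :
    ∃ C : ℕ, ∀ n, growth G (S : Set G) n ^ m ≤ K.index * growth G (S : Set G) (C * (n + 1)) := by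
  let U : Set G := symGen (S : Set G)
  have hUf : U.Finite := symGen_finite S
  obtain ⟨C, hC⟩ := schreier_bound (Set.pi Set.univ (fun _ : Fin m => U))
    (Set.Finite.pi' (fun _ => hUf) |>.subset (fun x hx i => hx i trivial)) K f U
    (exists_subset_pow _ hS)
  refine ⟨C, fun n => ?_⟩
  have hfin : Finite (↥(U ^ (C * (n + 1)))) := (finite_pow hUf _).to_subtype
  rw [growth, growth, wordBall_eq, wordBall_eq, Subgroup.index, ← Nat.card_prod]
  have hc : Nat.card (↥(symGen (S : Set G) ^ n)) ^ m
      = Nat.card (Fin m → ↥(symGen (S : Set G) ^ n)) := by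
    simp [Nat.card_fun]
  rw [hc]
  let v : (Fin m → ↥(U ^ n)) → (Fin m → G) := fun x i => (x i : G)
  have hv : ∀ x, v x ∈ (Set.pi Set.univ (fun _ : Fin m => U)) ^ n :=
    fun x => pi_pow m U n (fun i _ => (x i).2)
  let Φ : (Fin m → ↥(U ^ n)) → ((Fin m → G) ⧸ K) × ↥(U ^ (C * (n + 1))) := fun x =>
    (((v x)⁻¹ : Fin m → G), ⟨_, hC n (v x) (hv x)⟩)
  refine Nat.card_le_card_of_injective Φ ?_
  intro x y hxy
  have h1 : (((v x)⁻¹ : Fin m → G) : (Fin m → G) ⧸ K) = (((v y)⁻¹ : Fin m → G)) :=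
    congrArg Prod.fst hxy
  have h2 := congrArg Subtype.val (congrArg Prod.snd hxy)
  have h3 := congrArg Subtype.val (hf h2)
  have h4 : cosetRep K (v x) = cosetRep K (v y) := by
    simp only [cosetRep]; rw [h1]
  simp only [h4] at h3
  have h5 : v x = v y := mul_right_cancel h3
  funext i
  exact Subtype.ext (congrFun h5 i)

theorem exp_growth_of_sq (γ : ℕ → ℕ) (hmono : Monotone γ) (hunb : ∀ M, ∃ n, M ≤ γ n)
    (d D : ℕ) (hd : 1 ≤ d) (hD : 2 ≤ D) (h : ∀ n, 1 ≤ n → γ n ^ 2 ≤ d * γ (D * n)) :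
    ∃ c α : ℝ, 0 < c ∧ 0 < α ∧ ∃ N : ℕ, ∀ n, N ≤ n →
      Real.exp (c * (n : ℝ) ^ α) ≤ (γ n : ℝ) := by
  obtain ⟨n₁, hn₁⟩ := hunb (3 * d)
  let n₀ := n₁ + 1
  have hn₀ : 3 * d ≤ γ n₀ := hn₁.trans (hmono (by omega))
  have hdR : (1 : ℝ) ≤ d := by exact_mod_cast hd
  have hDR : (2 : ℝ) ≤ D := by exact_mod_cast hD
  have key : ∀ k : ℕ, (d : ℝ) * Real.exp (2 ^ k) ≤ γ (D ^ k * n₀) := by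
    intro k
    induction k with
    | zero =>
      have : (3 * d : ℝ) ≤ γ n₀ := by exact_mod_cast hn₀
      have he := Real.exp_one_lt_three
      simp only [pow_zero, one_mul]
      nlinarith
    | succ k ih =>
      have h1 := h (D ^ k * n₀) (Nat.mul_pos (by positivity) (by omega))
      have h2 : ((γ (D ^ k * n₀) : ℝ)) ^ 2 ≤ d * γ (D ^ (k + 1) * n₀) := by
        rw [pow_succ' D k, mul_assoc]
        exact_mod_cast h1
      have h3 : ((d : ℝ) * Real.exp (2 ^ k)) ^ 2 ≤ (γ (D ^ k * n₀) : ℝ) ^ 2 :=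
        pow_le_pow_left₀ (by positivity) ih 2
      have h4 : Real.exp (2 ^ (k + 1)) = Real.exp (2 ^ k) ^ 2 := by
        rw [← Real.exp_nat_mul]; congr 1; push_cast; ring
      rw [h4]
      have h5 : (d : ℝ) * (d * Real.exp (2 ^ k) ^ 2) ≤ d * γ (D ^ (k + 1) * n₀) := by
        nlinarith
      exact le_of_mul_le_mul_left h5 (by linarith)
  have hn₀R : (0 : ℝ) < n₀ := by
    have : 0 < n₀ := by omega
    exact_mod_cast this
  have hlogD : 0 < Real.log D := Real.log_pos (by linarith)
  have hα : 0 < Real.log 2 / Real.log D := div_pos (Real.log_pos (by norm_num)) hlogD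
  have hDα : (D : ℝ) ^ (Real.log 2 / Real.log D) = 2 := by
    rw [Real.rpow_def_of_pos (by linarith), mul_div_cancel₀ _ hlogD.ne', Real.exp_log (by norm_num)]
  refine ⟨((D * n₀ : ℝ)⁻¹) ^ (Real.log 2 / Real.log D), Real.log 2 / Real.log D,
    by positivity, hα, n₀, fun n hn => ?_⟩
  let k := Nat.log D (n / n₀)
  have hq : n / n₀ ≠ 0 := (Nat.div_pos hn (by omega)).ne'
  have hk1 : D ^ k * n₀ ≤ n := by
    have := Nat.pow_log_le_self D hq
    exact (Nat.mul_le_mul_right _ this).trans (Nat.div_mul_le_self _ _)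
  have hk2 : n < D ^ (k + 1) * n₀ := by
    have := Nat.lt_pow_succ_log_self (b := D) (by omega) (n / n₀)
    exact (Nat.div_lt_iff_lt_mul (by omega)).1 this
  have h1 : (γ (D ^ k * n₀) : ℝ) ≤ γ n := by exact_mod_cast hmono hk1
  have h2 : Real.exp (2 ^ k) ≤ γ (D ^ k * n₀) := by
    refine le_trans ?_ (key k)
    have := Real.exp_pos ((2 : ℝ) ^ k)
    nlinarith
  refine le_trans (Real.exp_le_exp.2 ?_) (h2.trans h1)
  rw [← Real.mul_rpow (by positivity) (by positivity)]
  have h3 : (D * n₀ : ℝ)⁻¹ * n ≤ (D : ℝ) ^ k := by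
    rw [inv_mul_le_iff₀ (by positivity)]
    have : (n : ℝ) ≤ (D : ℝ) ^ (k + 1) * n₀ := by exact_mod_cast hk2.le
    calc (n : ℝ) ≤ (D : ℝ) ^ (k + 1) * n₀ := this
      _ = _ := by ring
  calc ((D * n₀ : ℝ)⁻¹ * n) ^ (Real.log 2 / Real.log D)
      ≤ ((D : ℝ) ^ k) ^ (Real.log 2 / Real.log D) :=
        Real.rpow_le_rpow (by positivity) h3 hα.le
    _ = ((D : ℝ) ^ (Real.log 2 / Real.log D)) ^ k := by
        rw [← Real.rpow_natCast, ← Real.rpow_natCast, ← Real.rpow_mul (by positivity),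
          ← Real.rpow_mul (by positivity), mul_comm]
    _ = 2 ^ k := by rw [hDα]

/-- Every multilateral group has superpolynomial growth: if `G` is an infinite group
generated by a finite set `S`, and some finite-index subgroup `H` of `G` is isomorphic to
a finite-index subgroup `K` of `G^m` for some `m ≥ 2`, then
`γ(n) ≥ exp (c * n^α)` for some `c, α > 0` and all sufficiently large `n`. -/
theorem multilateral_superpolynomial_growth (G : Type*) [Group G] [Infinite G]
    (S : Finset G) (hS : Subgroup.closure (S : Set G) = ⊤)
    (m : ℕ) (hm : 2 ≤ m) (H : Subgroup G) (K : Subgroup (Fin m → G))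
    (hH : H.FiniteIndex) (hK : K.FiniteIndex) (e : H ≃* K) :
    ∃ c α : ℝ, 0 < c ∧ 0 < α ∧ ∃ N : ℕ, ∀ n, N ≤ n →
      Real.exp (c * (n : ℝ) ^ α) ≤ (growth G (S : Set G) n : ℝ) := by
  obtain ⟨C, hC⟩ := growth_pow_le S hS m K (H.subtype.comp e.symm.toMonoidHom)
    (H.subtype_injective.comp e.symm.injective)
  refine exp_growth_of_sq (growth G (S : Set G)) (fun a b h => growth_mono S h)
    (growth_unbounded S hS) K.index (2 * C + 2)
    (Nat.one_le_iff_ne_zero.2 hK.index_ne_zero) (by omega) (fun n hn => ?_)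
  calc growth G (S : Set G) n ^ 2 ≤ growth G (S : Set G) n ^ m :=
        Nat.pow_le_pow_right (growth_pos S n) hm
    _ ≤ K.index * growth G (S : Set G) (C * (n + 1)) := hC n
    _ ≤ _ := Nat.mul_le_mul_left _ (growth_mono S (by nlinarith))
end
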